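/- arXiv:1812.11058 — 3 statements merged into one kernel-verified Lean document; each statement's English description precedes it below -/
import Mathlib

section
/- Let X = projlim X_n p_n be a reduced regular projective limit of real vector lattices and let l : X → ℝ be linear and positive (l(x) ≥ 0 whenever x ≥ 0). Then there exists n₀ ∈ ℕ such that for every n ≥ n₀ there is a linear positive functional l_n : X_n → ℝ with l(x) = l_n(pr_n x) for all x ∈ X. Conversely, for any linear positive l_n : X_n → ℝ, the function x ↦ l_n(pr_n x) is a linear positive functional on X. -/
/-
A sequence `(X n)` of real vector lattices with positive linear maps
`p n : X (n+1) →ₗ[ℝ] X n` is given.  The projective limit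
`projlim Xₙ pₙ` is realized as the submodule of the product `∀ n, X n`
consisting of all `x` with `x n = p n (x (n+1))` for all `n`, ordered
componentwise (the subtype order induced from the product order).
-/

variable {X : ℕ → Type*} [∀ n, Lattice (X n)] [∀ n, AddCommGroup (X n)]
  [∀ n, Module ℝ (X n)]
  [∀ n, CovariantClass (X n) (X n) (· + ·) (· ≤ ·)]
  [∀ n, PosSMulMono ℝ (X n)]

/-- The projective limit of the inverse system `p`, as a submodule of the product
`∀ n, X n` (with the componentwise partial order). -/
def ProjLim (p : ∀ n, X (n + 1) →ₗ[ℝ] X n) : Submodule ℝ (∀ n, X n) where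
  carrier := {x | ∀ n, x n = p n (x (n + 1))}
  add_mem' := by
    intro x y hx hy n
    show x n + y n = p n (x (n + 1) + y (n + 1))
    rw [map_add, ← hx n, ← hy n]
  zero_mem' := by
    intro n
    show (0 : X n) = p n 0
    rw [map_zero]
  smul_mem' := by
    intro c x hx n
    show c • x n = p n (c • x (n + 1))
    rw [map_smul, ← hx n]

/-
STATEMENT 3.  On a reduced regular projective limit `X = projlim Xₙ pₙ`
of real vector lattices, every positive linear functional `l : X → ℝ`
factors, for all sufficiently large `n`, as `l = lₙ ∘ prₙ` with
`lₙ : Xₙ → ℝ` linear and positive; conversely any such composition is a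
positive linear functional on `X`.
-/
namespace ProjLim

theorem apply_eq_map {p : ∀ n, X (n + 1) →ₗ[ℝ] X n} {x : ∀ n, X n} (hx : x ∈ ProjLim p) (n : ℕ) :
    x n = p n (x (n + 1)) :=
  hx n

/-- If a coordinate of a point of the projective limit vanishes, so do all earlier ones. -/
theorem apply_eq_zero_of_le {p : ∀ n, X (n + 1) →ₗ[ℝ] X n} {x : ∀ n, X n} (hx : x ∈ ProjLim p)
    {m n : ℕ} (hmn : m ≤ n) (hn : x n = 0) : x m = 0 := by
  induction n, hmn using Nat.le_induction with
  | base => exact hn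
  | succ k _ ih => exact ih (by rw [apply_eq_map hx k, hn, map_zero])

/-- The coordinate projection of the projective limit onto `X n`. -/
def proj (p : ∀ n, X (n + 1) →ₗ[ℝ] X n) (n : ℕ) : ↥(ProjLim p) →ₗ[ℝ] X n :=
  (LinearMap.proj n).comp (ProjLim p).subtype

@[simp]
theorem proj_apply (p : ∀ n, X (n + 1) →ₗ[ℝ] X n) (n : ℕ) (x : ↥(ProjLim p)) :
    proj p n x = (x : ∀ m, X m) n :=
  rfl

/-- A regular projective limit contains the componentwise positive part of each of its points. -/
theorem sup_zero_mem {p : ∀ n, X (n + 1) →ₗ[ℝ] X n}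
    (hreg : ∀ n, ∀ a b : X (n + 1), p n (a ⊔ b) = p n a ⊔ p n b)
    {x : ∀ n, X n} (hx : x ∈ ProjLim p) : (fun n => x n ⊔ 0) ∈ ProjLim p := by
  intro n
  simp only
  rw [hreg, ← apply_eq_map hx n, map_zero]

/-- A sequence of nonnegative points of the projective limit, the `k`-th of which vanishes at the
coordinate `k`, has an upper bound for all its partial sums. -/
theorem exists_sum_le {p : ∀ n, X (n + 1) →ₗ[ℝ] X n} (x : ℕ → ↥(ProjLim p))
    (hx : ∀ k, 0 ≤ x k) (hzero : ∀ k, (x k : ∀ m, X m) k = 0) :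
    ∃ y : ↥(ProjLim p), ∀ N, ∑ k ∈ Finset.range N, x k ≤ y := by
  refine ⟨⟨fun m => ∑ k ∈ Finset.range m, (x k : ∀ m, X m) m, fun m => ?_⟩, fun N m => ?_⟩
  · simp only [map_sum]
    rw [Finset.sum_range_succ, ← apply_eq_map (x m).2 m, hzero m, add_zero]
    exact Finset.sum_congr rfl fun k _ => apply_eq_map (x k).2 m
  · have : IsOrderedAddMonoid (X m) := { add_le_add_left := fun _ _ h c => by gcongr }
    have hmax : ∑ k ∈ Finset.range m, (x k : ∀ m, X m) m =
        ∑ k ∈ Finset.range (max N m), (x k : ∀ m, X m) m := by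
      refine Finset.sum_subset (Finset.range_mono (le_max_right N m)) fun k _ hk => ?_
      exact apply_eq_zero_of_le (x k).2 (by simpa using hk) (hzero k)
    have hle : ∑ k ∈ Finset.range N, (x k : ∀ m, X m) m ≤
        ∑ k ∈ Finset.range (max N m), (x k : ∀ m, X m) m :=
      Finset.sum_le_sum_of_subset_of_nonneg (Finset.range_mono (le_max_left N m))
        fun k _ _ => hx k m
    have hsum : ((∑ k ∈ Finset.range N, x k : ↥(ProjLim p)) : ∀ m, X m) m =
        ∑ k ∈ Finset.range N, (x k : ∀ m, X m) m := by
      simpa only [proj_apply] using map_sum (proj p m) x (Finset.range N)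
    exact hsum.trans_le (hle.trans_eq hmax.symm)

/-- A positive functional on the projective limit vanishes on all nonnegative points with vanishing
`n`-th coordinate, for some `n`. -/
theorem exists_forall_nonneg_eq_zero {p : ∀ n, X (n + 1) →ₗ[ℝ] X n} (l : ↥(ProjLim p) →ₗ[ℝ] ℝ)
    (hl : ∀ x, 0 ≤ x → 0 ≤ l x) :
    ∃ n, ∀ x : ↥(ProjLim p), 0 ≤ x → (x : ∀ m, X m) n = 0 → l x = 0 := by
  by_contra! h
  choose x hx hzero hne using h
  have hlx : ∀ k, 0 < l (x k) := fun k => (hl _ (hx k)).lt_of_ne' (hne k)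
  obtain ⟨y, hy⟩ := exists_sum_le (fun k => (l (x k))⁻¹ • x k)
    (fun k m => smul_nonneg (inv_nonneg.2 (hlx k).le) (hx k m))
    (fun k => by simp [hzero k])
  obtain ⟨N, hN⟩ := exists_nat_gt (l y)
  have hbound : 0 ≤ l (y - ∑ k ∈ Finset.range N, (l (x k))⁻¹ • x k) :=
    hl _ fun m => sub_nonneg.2 (hy N m)
  have hsum : l (∑ k ∈ Finset.range N, (l (x k))⁻¹ • x k) = N := by
    simp [map_sum, inv_mul_cancel₀ (hne _)]
  rw [map_sub, hsum] at hbound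
  linarith

/-- On a regular projective limit, a functional that vanishes on the nonnegative points with
vanishing `n`-th coordinate vanishes on all points with vanishing `n`-th coordinate. -/
theorem eq_zero_of_forall_nonneg {p : ∀ n, X (n + 1) →ₗ[ℝ] X n}
    (hreg : ∀ n, ∀ a b : X (n + 1), p n (a ⊔ b) = p n a ⊔ p n b) (l : ↥(ProjLim p) →ₗ[ℝ] ℝ) {n : ℕ}
    (h : ∀ x : ↥(ProjLim p), 0 ≤ x → (x : ∀ m, X m) n = 0 → l x = 0)
    (x : ↥(ProjLim p)) (hx : (x : ∀ m, X m) n = 0) : l x = 0 := by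
  let y : ↥(ProjLim p) := ⟨_, sup_zero_mem hreg x.2⟩
  have hy : l y = 0 := h y (fun m => le_sup_right) (by simp [y, hx])
  have hyx : l (y - x) = 0 := h (y - x) (fun m => sub_nonneg.2 le_sup_left) (by simp [y, hx])
  rw [map_sub, hy] at hyx
  linarith

end ProjLim

theorem linear_positive_factors_through_projection
    (p : ∀ n, X (n + 1) →ₗ[ℝ] X n)
    (hpos : ∀ n, ∀ a : X (n + 1), 0 ≤ a → 0 ≤ p n a)
    (hreg : ∀ n, ∀ a b : X (n + 1), p n (a ⊔ b) = p n a ⊔ p n b)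
    (hred : ∀ n, ∀ y : X n, ∃ x : ∀ m, X m, x ∈ ProjLim p ∧ x n = y) :
    (∀ l : ↥(ProjLim p) →ₗ[ℝ] ℝ,
      (∀ x : ↥(ProjLim p), 0 ≤ x → 0 ≤ l x) →
      ∃ n₀ : ℕ, ∀ n, n₀ ≤ n → ∃ lₙ : X n →ₗ[ℝ] ℝ,
        (∀ u : X n, 0 ≤ u → 0 ≤ lₙ u) ∧
        (∀ x : ↥(ProjLim p), l x = lₙ ((x : ∀ m, X m) n))) ∧
    (∀ n : ℕ, ∀ lₙ : X n →ₗ[ℝ] ℝ,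
      (∀ u : X n, 0 ≤ u → 0 ≤ lₙ u) →
      ∃ l : ↥(ProjLim p) →ₗ[ℝ] ℝ,
        (∀ x : ↥(ProjLim p), 0 ≤ x → 0 ≤ l x) ∧
        (∀ x : ↥(ProjLim p), l x = lₙ ((x : ∀ m, X m) n))) := by
  refine ⟨fun l hl => ?_, fun n lₙ hlₙ =>
    ⟨lₙ.comp (ProjLim.proj p n), fun x hx => hlₙ _ (hx n), fun x => rfl⟩⟩
  obtain ⟨n₀, hn₀⟩ := ProjLim.exists_forall_nonneg_eq_zero l hl
  refine ⟨n₀, fun n hn => ?_⟩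
  have hker : ∀ x y : ↥(ProjLim p), (x : ∀ m, X m) n = (y : ∀ m, X m) n → l x = l y := by
    intro x y hxy
    have hsub : ((x - y : ↥(ProjLim p)) : ∀ m, X m) n = 0 := by simp [hxy]
    have := ProjLim.eq_zero_of_forall_nonneg hreg l hn₀ (x - y)
      (ProjLim.apply_eq_zero_of_le (x - y).2 hn hsub)
    rwa [map_sub, sub_eq_zero] at this
  have hsurj : Function.Surjective (ProjLim.proj p n) := fun y =>
    let ⟨x, hx, hxy⟩ := hred n y
    ⟨⟨x, hx⟩, hxy⟩
  obtain ⟨s, hs⟩ := (ProjLim.proj p n).exists_rightInverse_of_surjective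
    (LinearMap.range_eq_top.2 hsurj)
  have hs' : ∀ u, (s u : ∀ m, X m) n = u := fun u => LinearMap.congr_fun hs u
  refine ⟨l.comp s, fun u hu => ?_, fun x => hker _ _ (hs' _).symm⟩
  have hpart : l (s u) = l ⟨_, ProjLim.sup_zero_mem hreg (s u).2⟩ :=
    hker _ _ (by simp [hs', hu])
  rw [LinearMap.comp_apply, hpart]
  exact hl _ fun m => le_sup_right
end

section
/- Let X = projlim X_n p_n be a reduced regular projective limit of real vector lattices, H ⊆ X, and H_n := pr_n H ⊆ X_n. Let q₁ : X_1 → ℝ, let q := q₁ ∘ pr_1 restricted to H, and for n ≥ 2 let q_n := q₁ ∘ p_1 ∘ ⋯ ∘ p_{n-1} restricted to H_n (and q_1 restricted to H_1 for n = 1). Then for every n and every y ∈ X_n, the sup-projection of the supremal function spf_{H,q} satisfies sup{ spf_{H,q}(x) : x ∈ X, pr_n x = y } = spf_{H_n,q_n}(y), i.e. it equals sup{ q_n(h_n) : h_n ∈ H_n, h_n ≤ y }, where all suprema are taken in ℝ ∪ {±∞} (sup ∅ = -∞). -/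
/-
A sequence `(X n)` of real vector lattices with positive linear maps
`p n : X (n+1) →ₗ[ℝ] X n` is given.  The projective limit
`projlim Xₙ pₙ` is realized as the submodule of the product `∀ n, X n`
consisting of all `x` with `x n = p n (x (n+1))` for all `n`, ordered
componentwise (the subtype order induced from the product order).
-/

variable {X : ℕ → Type*} [∀ n, Lattice (X n)] [∀ n, AddCommGroup (X n)]
  [∀ n, Module ℝ (X n)]
  [∀ n, CovariantClass (X n) (X n) (· + ·) (· ≤ ·)]
  [∀ n, PosSMulMono ℝ (X n)]

/-- The supremal function generated by `q` relative to `H`: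
`spf H q x = sup { q h : h ∈ H, h ≤ x }`, with values in `EReal`
(`sSup ∅ = ⊥ = -∞`). -/
noncomputable def spf {Z : Type*} [Preorder Z] (H : Set Z) (q : Z → ℝ)
    (x : Z) : EReal :=
  sSup {r : EReal | ∃ h ∈ H, h ≤ x ∧ r = (q h : EReal)}

/-- The composite map `p 0 ∘ ⋯ ∘ p (n-1) : X n →ₗ[ℝ] X 0`. -/
def compP (p : ∀ n, X (n + 1) →ₗ[ℝ] X n) : ∀ n, X n →ₗ[ℝ] X 0
  | 0 => LinearMap.id
  | n + 1 => (compP p n).comp (p n)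

omit [∀ n, Lattice (X n)] [∀ n, CovariantClass (X n) (X n) (· + ·) (· ≤ ·)]
  [∀ n, PosSMulMono ℝ (X n)] in
/-- Composing the connecting maps down to level `0` recovers the `0`-th coordinate of a point
of the projective limit. -/
theorem compP_apply_of_mem_projLim (p : ∀ n, X (n + 1) →ₗ[ℝ] X n) {x : ∀ n, X n}
    (hx : x ∈ ProjLim p) (n : ℕ) : compP p n (x n) = x 0 := by
  induction n with
  | zero => rfl
  | succ n ih => rw [← ih, hx n]; rfl

omit [∀ n, CovariantClass (X n) (X n) (· + ·) (· ≤ ·)] [∀ n, PosSMulMono ℝ (X n)] in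
/-- If the connecting maps preserve binary suprema, the projective limit is closed under
componentwise suprema. -/
theorem sup_mem_projLim (p : ∀ n, X (n + 1) →ₗ[ℝ] X n)
    (hreg : ∀ n, ∀ a b : X (n + 1), p n (a ⊔ b) = p n a ⊔ p n b)
    {x y : ∀ n, X n} (hx : x ∈ ProjLim p) (hy : y ∈ ProjLim p) : x ⊔ y ∈ ProjLim p := by
  intro n
  rw [Pi.sup_apply, Pi.sup_apply, hreg, ← hx n, ← hy n]

/-
STATEMENT 13.  For a reduced regular projective limit of real vector
lattices, `H ⊆ X`, `q₁ : X₁ → ℝ` (here `X 0`), `q = q₁ ∘ pr₁` and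
`qₙ = q₁ ∘ p₁ ∘ ⋯ ∘ p_{n-1}`, the sup-projection of the supremal
function `spf_{H,q}` onto `Xₙ` equals the supremal function
`spf_{Hₙ,qₙ}`, where `Hₙ = prₙ H`.
-/
theorem supProj_of_spf_eq_spf_of_projections
    (p : ∀ n, X (n + 1) →ₗ[ℝ] X n)
    (hpos : ∀ n, ∀ a : X (n + 1), 0 ≤ a → 0 ≤ p n a)
    (hreg : ∀ n, ∀ a b : X (n + 1), p n (a ⊔ b) = p n a ⊔ p n b)
    (hred : ∀ n, ∀ y : X n, ∃ x : ∀ m, X m, x ∈ ProjLim p ∧ x n = y)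
    (H : Set ↥(ProjLim p)) (q1 : X 0 → ℝ) (n : ℕ) (y : X n) :
    sSup {r : EReal | ∃ x : ↥(ProjLim p), (x : ∀ m, X m) n = y ∧
        r = spf H (fun x' : ↥(ProjLim p) => q1 ((x' : ∀ m, X m) 0)) x} =
    spf ((fun x : ↥(ProjLim p) => (x : ∀ m, X m) n) '' H)
        (fun u : X n => q1 (compP p n u)) y := by
  apply le_antisymm
  · apply sSup_le
    rintro _ ⟨x, rfl, rfl⟩
    apply sSup_le
    rintro _ ⟨h, hH, hle, rfl⟩
    refine le_sSup ⟨_, ⟨h, hH, rfl⟩, hle n, ?_⟩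
    simp only [compP_apply_of_mem_projLim p h.2 n]
  · apply sSup_le
    rintro _ ⟨_, ⟨h, hH, rfl⟩, hle, rfl⟩
    obtain ⟨x, hx, rfl⟩ := hred n y
    let z : ProjLim p := ⟨x ⊔ h, sup_mem_projLim p hreg hx h.2⟩
    have hz : h ≤ z := fun m => le_sup_right (a := x m)
    calc ((q1 (compP p n ((h : ∀ m, X m) n)) : ℝ) : EReal)
        = q1 ((h : ∀ m, X m) 0) := by rw [compP_apply_of_mem_projLim p h.2 n]
      _ ≤ spf H (fun x' : ProjLim p => q1 ((x' : ∀ m, X m) 0)) z := le_sSup ⟨h, hH, hz, rfl⟩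
      _ ≤ _ := by exact le_sSup ⟨z, sup_eq_left.2 hle, rfl⟩
end

section
/- Let X = projlim X_n p_n be a reduced regular projective limit of real vector lattices, X_0 ⊆ X a linear subspace, q₁ : X_1 → ℝ increasing and concave, q := q₁ ∘ pr_1 : X → ℝ, H ⊆ X a convex set, and H_n := pr_n H. Assume: (ii) for every n and every y ∈ pr_n X_0 there is h ∈ H_n with h ≤ y; (iii–iv) for every sequence (h^(k)) in H bounded above and below in X, the upper limit inf_n sup_{k≥n} h^(k) exists in X and belongs to H; (v) whenever (h^(k)) ⊆ H is decreasing with inf_k q(h^(k)) > -∞, the sequence is bounded below in X and q(inf_k h^(k)) ≥ inf_k q(h^(k)). Then the supremal function spf_{H,q} is concave on X (with values in ℝ ∪ {±∞}), and for every x ∈ X_0: spf_{H,q}(x) = inf{ a(x) : a : X_0 → ℝ affine, q(h) ≤ a(x') for all h ∈ H, x' ∈ X_0 with h ≤ x' } (infimum in ℝ ∪ {±∞}, inf ∅ = +∞). If moreover 0 ∈ H and q₁(0) ≥ 0, then spf_{H,q}(x) ≥ 0 for all x ≥ 0, and the infimum can be restricted to affine functions of the form a = l + c with l : X_0 → ℝ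 a positive linear functional and c ≥ 0. -/
/-
A sequence `(X n)` of real vector lattices with positive linear maps
`p n : X (n+1) →ₗ[ℝ] X n` is given.  The projective limit
`projlim Xₙ pₙ` is realized as the submodule of the product `∀ n, X n`
consisting of all `x` with `x n = p n (x (n+1))` for all `n`, ordered
componentwise (the subtype order induced from the product order).
-/

variable {X : ℕ → Type*} [∀ n, Lattice (X n)] [∀ n, AddCommGroup (X n)]
  [∀ n, Module ℝ (X n)]
  [∀ n, CovariantClass (X n) (X n) (· + ·) (· ≤ ·)]
  [∀ n, PosSMulMono ℝ (X n)]

/-- A real-valued concave function on a real vector space has a supporting affine function at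
every point. -/
theorem exists_linear_support_of_concave {E : Type*} [AddCommGroup E] [Module ℝ E] (g : E → ℝ)
    (hg : ∀ t : ℝ, 0 < t → t < 1 → ∀ a b : E,
      t * g a + (1 - t) * g b ≤ g (t • a + (1 - t) • b)) (x : E) :
    ∃ l : E →ₗ[ℝ] ℝ, ∀ y, g y ≤ g x + l (y - x) := by
  let C : ConvexCone ℝ (E × ℝ) :=
    { carrier := {z | ∃ t : ℝ, 0 < t ∧ g x - g (x + t • z.1) ≤ t * z.2}
      smul_mem' := by
        rintro c hc ⟨v, r⟩ ⟨t, ht, h⟩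
        refine ⟨t / c, div_pos ht hc, ?_⟩
        have h1 : (t / c) • (c • v) = t • v := by
          rw [smul_smul, div_mul_cancel₀ _ hc.ne']
        have h2 : t / c * (c * r) = t * r := by
          rw [← mul_assoc, div_mul_cancel₀ _ hc.ne']
        simpa [h1, h2] using h
      add_mem' := by
        rintro ⟨v, r⟩ ⟨t, ht, h⟩ ⟨v', r'⟩ ⟨t', ht', h'⟩
        have hs : 0 < t + t' := add_pos ht ht'
        refine ⟨t * t' / (t + t'), by positivity, ?_⟩
        have key := hg (t' / (t + t')) (by positivity) (by rw [div_lt_one hs]; linarith)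
          (x + t • v) (x + t' • v')
        have e1 : 1 - t' / (t + t') = t / (t + t') := by field_simp; ring
        have e2 : (t' / (t + t')) • (x + t • v) + (1 - t' / (t + t')) • (x + t' • v') =
            x + (t * t' / (t + t')) • (v + v') := by
          rw [e1]
          match_scalars <;> field_simp
          ring
        rw [e2, e1] at key
        simp only at h h'
        have k1 := mul_le_mul_of_nonneg_left h (by positivity : 0 ≤ t' / (t + t'))
        have k2 := mul_le_mul_of_nonneg_left h' (by positivity : 0 ≤ t / (t + t'))
        have e3 : t' / (t + t') * (t * r) + t / (t + t') * (t' * r') =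
            t * t' / (t + t') * (r + r') := by field_simp
        have e4 : t' / (t + t') * g x + t / (t + t') * g x = g x := by field_simp; ring
        simp only [Prod.mk_add_mk]
        linarith }
  let f : (E × ℝ) →ₗ.[ℝ] ℝ :=
    ⟨LinearMap.ker (LinearMap.fst ℝ E ℝ), (LinearMap.snd ℝ E ℝ).comp (Submodule.subtype _)⟩
  obtain ⟨L, hL, hLC⟩ := riesz_extension (C.toPointedCone ⟨1, one_pos, by simp⟩) f
    (by
      rintro ⟨⟨v, r⟩, hv⟩ ⟨t, ht, h⟩
      have hv' : v = 0 := hv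
      subst hv'
      simp only [smul_zero, add_zero, sub_self] at h
      exact nonneg_of_mul_nonneg_right h ht)
    (by
      rintro ⟨v, r⟩
      refine ⟨⟨(0, g x - g (x + v) - r), by simp [f]⟩, 1, one_pos, ?_⟩
      simp)
  have hL0 : ∀ r : ℝ, L (0, r) = r := fun r => hL ⟨(0, r), by simp [f]⟩
  refine ⟨L.comp (LinearMap.inl ℝ E ℝ), fun y => ?_⟩
  have hy : ((y - x, g x - g y) : E × ℝ) ∈ C := ⟨1, one_pos, by simp⟩
  have h1 := hLC _ hy
  have h2 : ((y - x, g x - g y) : E × ℝ) = (y - x, 0) + (0, g x - g y) := by simp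
  rw [h2, map_add, hL0] at h1
  simp only [LinearMap.comp_apply, LinearMap.inl_apply]
  linarith

theorem combination_csSup_le_csSup {A B C : Set ℝ} (hA : A.Nonempty) (hB : B.Nonempty)
    (hC : BddAbove C) {t : ℝ} (h0 : 0 < t) (h1 : t < 1)
    (h : ∀ a ∈ A, ∀ b ∈ B, ∃ c ∈ C, t * a + (1 - t) * b ≤ c) :
    t * sSup A + (1 - t) * sSup B ≤ sSup C := by
  have h1' : 0 < 1 - t := by linarith
  have hAB : ∀ b ∈ B, t * sSup A + (1 - t) * b ≤ sSup C := by
    intro b hb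
    have : sSup A ≤ (sSup C - (1 - t) * b) / t := by
      refine csSup_le hA fun a ha => ?_
      obtain ⟨c, hc, hle⟩ := h a ha b hb
      rw [le_div_iff₀ h0]
      linarith [le_csSup hC hc]
    rw [le_div_iff₀ h0] at this
    linarith
  have : sSup B ≤ (sSup C - t * sSup A) / (1 - t) := by
    refine csSup_le hB fun b hb => ?_
    rw [le_div_iff₀ h1']
    linarith [hAB b hb]
  rw [le_div_iff₀ h1'] at this
  linarith

theorem le_spf {Z : Type*} [Preorder Z] {H : Set Z} {q : Z → ℝ} {h x : Z} (hh : h ∈ H)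
    (hx : h ≤ x) : (q h : EReal) ≤ spf H q x :=
  le_sSup ⟨h, hh, hx, rfl⟩

theorem spf_le {Z : Type*} [Preorder Z] {H : Set Z} {q : Z → ℝ} {x : Z} {b : EReal}
    (hb : ∀ h ∈ H, h ≤ x → (q h : EReal) ≤ b) : spf H q x ≤ b := by
  refine sSup_le ?_
  rintro _ ⟨h, hh, hx, rfl⟩
  exact hb h hh hx

theorem spf_eq_coe_csSup {Z : Type*} [Preorder Z] {H : Set Z} {q : Z → ℝ} {x : Z}
    (hne : ∃ h ∈ H, h ≤ x) (hbdd : BddAbove {r : ℝ | ∃ h ∈ H, h ≤ x ∧ r = q h}) :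
    spf H q x = (sSup {r : ℝ | ∃ h ∈ H, h ≤ x ∧ r = q h} : ℝ) := by
  obtain ⟨h₀, hh₀, hx₀⟩ := hne
  apply le_antisymm
  · exact spf_le fun h hh hx => EReal.coe_le_coe_iff.2 (le_csSup hbdd ⟨h, hh, hx, rfl⟩)
  · refine EReal.le_of_forall_lt_iff_le.1 fun c hc => ?_
    rw [EReal.coe_le_coe_iff]
    refine csSup_le ⟨_, h₀, hh₀, hx₀, rfl⟩ ?_
    rintro _ ⟨h, hh, hx, rfl⟩
    exact EReal.coe_le_coe_iff.1 ((le_spf hh hx).trans hc.le)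

/-- The supremal function of a concave function on a convex set is concave where it is bounded
above. -/
theorem spf_concave {Z : Type*} [AddCommGroup Z] [PartialOrder Z] [IsOrderedAddMonoid Z]
    [Module ℝ Z] [PosSMulMono ℝ Z] {H : Set Z} {q : Z → ℝ} (hqm : Monotone q)
    {t : ℝ} (h0 : 0 < t) (h1 : t < 1)
    (hq : ∀ a b : Z, t * q a + (1 - t) * q b ≤ q (t • a + (1 - t) • b))
    (hH : ∀ h ∈ H, ∀ h' ∈ H, t • h + (1 - t) • h' ∈ H) (x y : Z) :
    (t : EReal) * spf H q x + ((1 - t : ℝ) : EReal) * spf H q y ≤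
      spf H q (t • x + (1 - t) • y) := by
  have h1' : 0 < 1 - t := by linarith
  have hbdd : ∀ z, BddAbove {r : ℝ | ∃ h ∈ H, h ≤ z ∧ r = q h} := by
    rintro z
    refine ⟨q z, ?_⟩
    rintro _ ⟨h, -, hz, rfl⟩
    exact hqm hz
  have hbot : ∀ z, (¬ ∃ h ∈ H, h ≤ z) → spf H q z = ⊥ := fun z hz =>
    le_bot_iff.1 (spf_le fun h hh hle => absurd ⟨h, hh, hle⟩ hz)
  have hcomb : ∀ {h h' : Z}, h ≤ x → h' ≤ y → t • h + (1 - t) • h' ≤ t • x + (1 - t) • y :=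
    fun hx hy => add_le_add (smul_le_smul_of_nonneg_left hx h0.le)
      (smul_le_smul_of_nonneg_left hy h1'.le)
  by_cases hx : ∃ h ∈ H, h ≤ x
  swap
  · rw [hbot x hx, EReal.coe_mul_bot_of_pos h0, EReal.bot_add]
    exact bot_le
  by_cases hy : ∃ h ∈ H, h ≤ y
  swap
  · rw [hbot y hy, EReal.coe_mul_bot_of_pos h1', EReal.add_bot]
    exact bot_le
  obtain ⟨a, ha, hax⟩ := hx
  obtain ⟨b, hb, hby⟩ := hy
  rw [spf_eq_coe_csSup ⟨a, ha, hax⟩ (hbdd _), spf_eq_coe_csSup ⟨b, hb, hby⟩ (hbdd _),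
    spf_eq_coe_csSup ⟨_, hH a ha b hb, hcomb hax hby⟩ (hbdd _)]
  norm_cast
  refine combination_csSup_le_csSup ?_ ?_ (hbdd _) h0 h1 ?_
  · exact ⟨_, a, ha, hax, rfl⟩
  · exact ⟨_, b, hb, hby, rfl⟩
  rintro _ ⟨h, hh, hhx, rfl⟩ _ ⟨h', hh', hhy, rfl⟩
  exact ⟨_, ⟨_, hH h hh h' hh', hcomb hhx hhy, rfl⟩, hq h h'⟩

section

omit [∀ n, CovariantClass (X n) (X n) (· + ·) (· ≤ ·)] [∀ n, PosSMulMono ℝ (X n)]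

omit [∀ n, Lattice (X n)] in
theorem ProjLim.apply_succ {p : ∀ n, X (n + 1) →ₗ[ℝ] X n} (a : ↥(ProjLim p)) (n : ℕ) :
    p n ((a : ∀ m, X m) (n + 1)) = (a : ∀ m, X m) n :=
  (a.2 n).symm

theorem ProjLim.apply_le_of_le {p : ∀ n, X (n + 1) →ₗ[ℝ] X n} (hp : ∀ n, Monotone (p n))
    {a b : ↥(ProjLim p)} {m n : ℕ} (hmn : m ≤ n)
    (h : (a : ∀ m, X m) n ≤ (b : ∀ m, X m) n) : (a : ∀ m, X m) m ≤ (b : ∀ m, X m) m := by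
  induction n, hmn using Nat.le_induction with
  | base => exact h
  | succ n _ ih =>
    apply ih
    have := hp n h
    rwa [ProjLim.apply_succ, ProjLim.apply_succ] at this

/-- The componentwise supremum in a regular projective limit. -/
def ProjLim.sup {p : ∀ n, X (n + 1) →ₗ[ℝ] X n}
    (hreg : ∀ n, ∀ a b : X (n + 1), p n (a ⊔ b) = p n a ⊔ p n b) (a b : ↥(ProjLim p)) :
    ↥(ProjLim p) :=
  ⟨fun n => (a : ∀ m, X m) n ⊔ (b : ∀ m, X m) n, fun n => by
    rw [hreg, ProjLim.apply_succ, ProjLim.apply_succ]⟩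

theorem ProjLim.isLUB_sup {p : ∀ n, X (n + 1) →ₗ[ℝ] X n}
    (hreg : ∀ n, ∀ a b : X (n + 1), p n (a ⊔ b) = p n a ⊔ p n b) (a b : ↥(ProjLim p)) :
    IsLUB {a, b} (ProjLim.sup hreg a b) := by
  constructor
  · rintro c (rfl | rfl)
    · exact fun n => le_sup_left
    · exact fun n => le_sup_right
  · intro c hc n
    exact sup_le (hc (Or.inl rfl) n) (hc (Or.inr rfl) n)

/-- A sequence whose `k`-th term lies below `x` in the `k`-th coordinate for all `k ≥ n` has an
upper bound for its tail from `n` on which agrees with `x` up to the `n`-th coordinate. -/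
theorem ProjLim.exists_tail_bound {p : ∀ n, X (n + 1) →ₗ[ℝ] X n} (hp : ∀ n, Monotone (p n))
    (hreg : ∀ n, ∀ a b : X (n + 1), p n (a ⊔ b) = p n a ⊔ p n b) (x : ↥(ProjLim p))
    (h : ℕ → ↥(ProjLim p)) (hx : ∀ k, (h k : ∀ m, X m) k ≤ (x : ∀ m, X m) k) (n : ℕ) :
    ∃ u : ↥(ProjLim p), (∀ k, n ≤ k → h k ≤ u) ∧
      ∀ m, m ≤ n → (u : ∀ m, X m) m = (x : ∀ m, X m) m := by
  let U : ℕ → ↥(ProjLim p) := fun j =>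
    Nat.rec x (fun j y => ProjLim.sup hreg y (h (n + j))) j
  have hU : ∀ j, U (j + 1) = ProjLim.sup hreg (U j) (h (n + j)) := fun j => rfl
  have hUmono : Monotone U := monotone_nat_of_le_succ fun j m => le_sup_left
  have hxU : ∀ j, x ≤ U j := fun j => hUmono (Nat.zero_le j)
  have hstab : ∀ j m, m ≤ n + j → (U (j + 1)).1 m = (U j).1 m := by
    intro j m hm
    rw [hU]
    exact sup_eq_left.2 ((ProjLim.apply_le_of_le hp hm (hx _)).trans (hxU j m))
  have hstab' : ∀ i j, i ≤ j → ∀ m, m ≤ n + i →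
      (U j).1 m = (U i).1 m := by
    intro i j hij m hm
    induction j, hij using Nat.le_induction with
    | base => rfl
    | succ j hj ih => rw [hstab j m (by omega), ih]
  refine ⟨⟨fun m => (U m).1 m, fun m => ?_⟩, ?_, ?_⟩
  · rw [ProjLim.apply_succ]
    exact (hstab m m (by omega)).symm
  · intro k hk m
    obtain ⟨j, rfl⟩ := Nat.exists_eq_add_of_le hk
    show (h (n + j)).1 m ≤ (U m).1 m
    by_cases hm : m ≤ n + j
    · exact (ProjLim.apply_le_of_le hp hm (hx _)).trans (hxU m m)
    · have h1 : h (n + j) ≤ U (j + 1) := fun m => le_sup_right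
      exact (h1.trans (hUmono (by omega : j + 1 ≤ m))) m
  · intro m hm
    exact hstab' 0 m (Nat.zero_le _) m (by omega)



end

/-- Every sequence in `H` bounded above and below has an upper limit, and it belongs to `H`. -/
def LimsupClosed {Z : Type*} [PartialOrder Z] (H : Set Z) : Prop :=
  ∀ h : ℕ → Z, (∀ k, h k ∈ H) → (∃ u, ∀ k, h k ≤ u) → (∃ b, ∀ k, b ≤ h k) →
    ∃ s : ℕ → Z, (∀ n : ℕ, IsLUB {y | ∃ k, n ≤ k ∧ y = h k} (s n)) ∧
      ∃ v ∈ H, IsGLB (Set.range s) v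

namespace LimsupClosed

variable {Z : Type*} [PartialOrder Z] {H : Set Z}

theorem isLUB_mem_of_tails (hH : LimsupClosed H) {h : ℕ → Z} (hh : ∀ k, h k ∈ H)
    (hb : ∃ b, ∀ k, b ≤ h k) {c : Z}
    (hc : ∀ n, IsLUB {y | ∃ k, n ≤ k ∧ y = h k} c) : c ∈ H := by
  obtain ⟨s, hs, v, hv, hvs⟩ := hH h hh ⟨c, fun k => (hc 0).1 ⟨k, k.zero_le, rfl⟩⟩ hb
  have hsc : s = fun _ => c := funext fun n => (hs n).unique (hc n)
  rw [hsc, Set.range_const] at hvs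
  rwa [← hvs.unique isGLB_singleton]

theorem isLUB_pair_mem (hH : LimsupClosed H) {a b c d : Z} (ha : a ∈ H) (hb : b ∈ H)
    (hc : IsLUB {a, b} c) (hda : d ≤ a) (hdb : d ≤ b) : c ∈ H := by
  refine hH.isLUB_mem_of_tails (h := fun k => if Even k then a else b) ?_ ⟨d, ?_⟩ fun n => ?_
  · intro k
    split_ifs <;> assumption
  · intro k
    split_ifs <;> assumption
  · convert hc using 1
    ext y
    constructor
    · rintro ⟨k, -, rfl⟩
      split_ifs <;> simp
    · rintro (rfl | rfl)
      · exact ⟨2 * n, by omega, by simp⟩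
      · exact ⟨2 * n + 1, by omega, by simp⟩

theorem exists_isLUB_of_monotone (hH : LimsupClosed H) {h : ℕ → Z} (hh : ∀ k, h k ∈ H)
    (hmono : Monotone h) {u : Z} (hu : ∀ k, h k ≤ u) : ∃ v ∈ H, IsLUB (Set.range h) v := by
  have hb : ∃ b, ∀ k, b ≤ h k := ⟨h 0, fun k => hmono k.zero_le⟩
  obtain ⟨s, hs, -⟩ := hH h hh ⟨u, hu⟩ hb
  have hub : ∀ k, h k ≤ s 0 := fun k => (hs 0).1 ⟨k, k.zero_le, rfl⟩
  refine ⟨s 0, hH.isLUB_mem_of_tails hh hb fun n => ⟨?_, fun c hc => (hs 0).2 ?_⟩, ?_, ?_⟩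
  · rintro _ ⟨k, -, rfl⟩
    exact hub k
  · rintro _ ⟨k, -, rfl⟩
    exact (hmono (le_max_left k n)).trans (hc ⟨_, le_max_right k n, rfl⟩)
  · rintro _ ⟨k, rfl⟩
    exact hub k
  · intro c hc
    refine (hs 0).2 ?_
    rintro _ ⟨k, -, rfl⟩
    exact hc ⟨k, rfl⟩

theorem exists_isGLB_of_antitone (hH : LimsupClosed H) {h : ℕ → Z} (hh : ∀ k, h k ∈ H)
    (hanti : Antitone h) {b : Z} (hb : ∀ k, b ≤ h k) : ∃ v ∈ H, IsGLB (Set.range h) v := by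
  obtain ⟨s, hs, v, hv, hvs⟩ := hH h hh ⟨h 0, fun k => hanti k.zero_le⟩ ⟨b, hb⟩
  have hsh : s = h := by
    funext n
    refine (hs n).unique ⟨?_, fun c hc => hc ⟨n, le_rfl, rfl⟩⟩
    rintro _ ⟨k, hk, rfl⟩
    exact hanti hk
  exact ⟨v, hv, hsh ▸ hvs⟩

end LimsupClosed

omit [∀ n, PosSMulMono ℝ (X n)] in
/-- In a regular projective limit, minorants of `x` coordinate by coordinate, with `q₁`-values at
least `c`, can be amalgamated into a single minorant of `x` with `q₁`-value at least `c`. -/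
theorem ProjLim.exists_le_of_forall_apply_le {p : ∀ n, X (n + 1) →ₗ[ℝ] X n}
    (hp : ∀ n, Monotone (p n))
    (hreg : ∀ n, ∀ a b : X (n + 1), p n (a ⊔ b) = p n a ⊔ p n b)
    {q1 : X 0 → ℝ} (hq1 : Monotone q1) {H : Set ↥(ProjLim p)} (hH : LimsupClosed H)
    (hqv : ∀ h : ℕ → ↥(ProjLim p), (∀ k, h k ∈ H) →
      (∀ k, h (k + 1) ≤ h k) →
      BddBelow (Set.range fun k => q1 ((h k : ∀ m, X m) 0)) →
      (∃ b : ↥(ProjLim p), ∀ k, b ≤ h k) ∧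
      (∀ w : ↥(ProjLim p), IsGLB (Set.range h) w →
        (⨅ k, q1 ((h k : ∀ m, X m) 0)) ≤ q1 ((w : ∀ m, X m) 0)))
    {x : ↥(ProjLim p)} {c : ℝ}
    (hc : ∀ n, ∃ h ∈ H, (h : ∀ m, X m) n ≤ (x : ∀ m, X m) n ∧ c ≤ q1 ((h : ∀ m, X m) 0)) :
    ∃ g ∈ H, g ≤ x ∧ c ≤ q1 ((g : ∀ m, X m) 0) := by
  choose h hhH hhx hhc using hc
  have hneg : ∀ {a b : ↥(ProjLim p)}, a ≤ b → -b ≤ -a := fun hab m => neg_le_neg_iff.2 (hab m)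
  have hsup : ∀ a ∈ H, ∀ b ∈ H, ProjLim.sup hreg a b ∈ H := fun a ha b hb => by
    have hlub := ProjLim.isLUB_sup hreg (-a) (-b)
    refine hH.isLUB_pair_mem ha hb (ProjLim.isLUB_sup hreg a b)
      (d := -ProjLim.sup hreg (-a) (-b)) ?_ ?_
    · simpa using hneg (hlub.1 (Or.inl rfl))
    · simpa using hneg (hlub.1 (Or.inr rfl))
  have htail : ∀ n, ∃ g ∈ H, IsLUB {y | ∃ k, n ≤ k ∧ y = h k} g := by
    intro n
    obtain ⟨u, hu, -⟩ := ProjLim.exists_tail_bound hp hreg x h hhx n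
    let G : ℕ → ↥(ProjLim p) := fun j =>
      Nat.rec (h n) (fun j y => ProjLim.sup hreg y (h (n + (j + 1)))) j
    have hGlub : ∀ j, IsLUB {G j, h (n + (j + 1))} (G (j + 1)) :=
      fun j => ProjLim.isLUB_sup hreg _ _
    have hGH : ∀ j, G j ∈ H := by
      intro j
      induction j with
      | zero => exact hhH n
      | succ j ih => exact hsup _ ih _ (hhH _)
    have hGmono : Monotone G := monotone_nat_of_le_succ fun j => (hGlub j).1 (Or.inl rfl)
    have hGle : ∀ w, (∀ k, n ≤ k → h k ≤ w) → ∀ j, G j ≤ w := by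
      intro w hw j
      induction j with
      | zero => exact hw n le_rfl
      | succ j ih =>
        refine (hGlub j).2 ?_
        rintro _ (rfl | rfl)
        · exact ih
        · exact hw _ (by omega)
    have hhG : ∀ j, h (n + j) ≤ G j := by
      rintro (_ | j)
      · exact le_rfl
      · exact (hGlub j).1 (Or.inr rfl)
    obtain ⟨g, hg, hglub⟩ := hH.exists_isLUB_of_monotone hGH hGmono (hGle u hu)
    refine ⟨g, hg, ?_, fun w hw => hglub.2 ?_⟩
    · rintro _ ⟨k, hk, rfl⟩
      obtain ⟨j, rfl⟩ := Nat.exists_eq_add_of_le hk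
      exact (hhG j).trans (hglub.1 ⟨j, rfl⟩)
    · rintro _ ⟨j, rfl⟩
      exact hGle w (fun k hk => hw ⟨k, hk, rfl⟩) j
  choose g hgH hg using htail
  have hganti : Antitone g := fun m n hmn => (hg n).2 <| by
    rintro _ ⟨k, hk, rfl⟩
    exact (hg m).1 ⟨k, hmn.trans hk, rfl⟩
  have hcg : ∀ n, c ≤ q1 ((g n : ∀ m, X m) 0) := fun n =>
    (hhc n).trans (hq1 ((hg n).1 ⟨n, le_rfl, rfl⟩ 0))
  have hbdd : BddBelow (Set.range fun k => q1 ((g k : ∀ m, X m) 0)) := by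
    refine ⟨c, ?_⟩
    rintro _ ⟨k, rfl⟩
    exact hcg k
  obtain ⟨⟨b, hb⟩, hq⟩ := hqv g hgH (fun k => hganti k.le_succ) hbdd
  obtain ⟨w, hwH, hw⟩ := hH.exists_isGLB_of_antitone hgH hganti hb
  refine ⟨w, hwH, fun n => ?_, (le_ciInf hcg).trans (hq w hw)⟩
  obtain ⟨u, hu, hux⟩ := ProjLim.exists_tail_bound hp hreg x h hhx n
  have hgu : g n ≤ u := (hg n).2 <| by
    rintro _ ⟨k, hk, rfl⟩
    exact hu k hk
  exact (((hw.1 ⟨n, rfl⟩).trans hgu) n).trans (hux n le_rfl).le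

/-
STATEMENT 17.  (Vector-affine version for a convex set `H`, `𝕂 = ℝ`.)
With `q₁ : X₁ → ℝ` increasing and concave, `q = q₁ ∘ pr₁`, `H ⊆ X` a
convex set satisfying (ii), (iii–iv) and (v), the supremal function
`spf H q` is concave on `X` and is represented on the linear subspace
`X₀` as the infimum of its affine sweepings-out; if moreover `0 ∈ H`
and `q₁ 0 ≥ 0`, then `spf H q` is positive and the infimum may be
restricted to affine functions `l + c` with `l` positive linear, `c ≥ 0`.
-/
theorem spf_representation_by_affine_sweepings
    (p : ∀ n, X (n + 1) →ₗ[ℝ] X n)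
    (hpos : ∀ n, ∀ a : X (n + 1), 0 ≤ a → 0 ≤ p n a)
    (hreg : ∀ n, ∀ a b : X (n + 1), p n (a ⊔ b) = p n a ⊔ p n b)
    (hred : ∀ n, ∀ y : X n, ∃ x : ∀ m, X m, x ∈ ProjLim p ∧ x n = y)
    (X₀ : Submodule ℝ ↥(ProjLim p))
    (q1 : X 0 → ℝ) (hq1mono : Monotone q1)
    (hq1conc : ∀ t : ℝ, 0 < t → t < 1 → ∀ a b : X 0,
      t * q1 a + (1 - t) * q1 b ≤ q1 (t • a + (1 - t) • b))
    (H : Set ↥(ProjLim p))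
    (hHconv : ∀ t : ℝ, 0 < t → t < 1 → ∀ h ∈ H, ∀ h' ∈ H,
      t • h + (1 - t) • h' ∈ H)
    -- (ii)
    (hmin : ∀ n : ℕ,
      ∀ y ∈ (fun x : ↥(ProjLim p) => (x : ∀ m, X m) n) '' (X₀ : Set ↥(ProjLim p)),
      ∃ h ∈ (fun x : ↥(ProjLim p) => (x : ∀ m, X m) n) '' H, h ≤ y)
    -- (iii–iv)
    (hlimsup : ∀ h : ℕ → ↥(ProjLim p), (∀ k, h k ∈ H) →
      (∃ u : ↥(ProjLim p), ∀ k, h k ≤ u) →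
      (∃ b : ↥(ProjLim p), ∀ k, b ≤ h k) →
      ∃ s : ℕ → ↥(ProjLim p),
        (∀ n : ℕ, IsLUB {y : ↥(ProjLim p) | ∃ k, n ≤ k ∧ y = h k} (s n)) ∧
        ∃ v ∈ H, IsGLB (Set.range s) v)
    -- (v)
    (hqv : ∀ h : ℕ → ↥(ProjLim p), (∀ k, h k ∈ H) →
      (∀ k, h (k + 1) ≤ h k) →
      BddBelow (Set.range fun k => q1 ((h k : ∀ m, X m) 0)) →
      (∃ b : ↥(ProjLim p), ∀ k, b ≤ h k) ∧
      (∀ w : ↥(ProjLim p), IsGLB (Set.range h) w →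
        (⨅ k, q1 ((h k : ∀ m, X m) 0)) ≤ q1 ((w : ∀ m, X m) 0))) :
    -- spf is concave on X
    (∀ t : ℝ, 0 < t → t < 1 → ∀ x y : ↥(ProjLim p),
      (t : EReal) * spf H (fun x' : ↥(ProjLim p) => q1 ((x' : ∀ m, X m) 0)) x +
        ((1 - t : ℝ) : EReal) *
          spf H (fun x' : ↥(ProjLim p) => q1 ((x' : ∀ m, X m) 0)) y ≤
        spf H (fun x' : ↥(ProjLim p) => q1 ((x' : ∀ m, X m) 0))
          (t • x + (1 - t) • y)) ∧
    -- representation by affine sweepings-out on X₀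
    (∀ x : ↥(ProjLim p), ∀ hx : x ∈ X₀,
      spf H (fun x' : ↥(ProjLim p) => q1 ((x' : ∀ m, X m) 0)) x =
        sInf {r : EReal | ∃ a : ↥X₀ → ℝ,
          (∀ t : ℝ, 0 < t → t < 1 → ∀ u v : ↥X₀,
            a (t • u + (1 - t) • v) = t * a u + (1 - t) * a v) ∧
          (∀ h ∈ H, ∀ x' : ↥X₀, h ≤ (x' : ↥(ProjLim p)) →
            q1 ((h : ∀ m, X m) 0) ≤ a x') ∧
          r = (a ⟨x, hx⟩ : EReal)}) ∧
    -- the positive refinement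
    ((0 : ↥(ProjLim p)) ∈ H → 0 ≤ q1 0 →
      (∀ x : ↥(ProjLim p), 0 ≤ x →
        0 ≤ spf H (fun x' : ↥(ProjLim p) => q1 ((x' : ∀ m, X m) 0)) x) ∧
      (∀ x : ↥(ProjLim p), ∀ hx : x ∈ X₀,
        spf H (fun x' : ↥(ProjLim p) => q1 ((x' : ∀ m, X m) 0)) x =
          sInf {r : EReal | ∃ (l : X₀ →ₗ[ℝ] ℝ) (c : ℝ), 0 ≤ c ∧
            (∀ x' : ↥X₀, 0 ≤ (x' : ↥(ProjLim p)) → 0 ≤ l x') ∧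
            (∀ h ∈ H, ∀ x' : ↥X₀, h ≤ (x' : ↥(ProjLim p)) →
              q1 ((h : ∀ m, X m) 0) ≤ l x' + c) ∧
            r = ((l ⟨x, hx⟩ + c : ℝ) : EReal)})) := by
  have hp : ∀ n, Monotone (p n) := fun n a b hab => by
    have := hpos n (b - a) (sub_nonneg.2 hab)
    rwa [map_sub, sub_nonneg] at this
  have : IsOrderedAddMonoid ↥(ProjLim p) :=
    ⟨fun a b hab c m => add_le_add_left (hab m) _, fun a b hab c m => add_le_add_right (hab m) _⟩
  have : PosSMulMono ℝ ↥(ProjLim p) :=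
    ⟨fun t ht a b hab m => smul_le_smul_of_nonneg_left (hab m) ht⟩
  have hsupport : ∀ n (x : ↥X₀) (d : ℝ),
      (∀ h ∈ H, (h : ∀ m, X m) n ≤ (x : ↥(ProjLim p)).1 n → q1 ((h : ∀ m, X m) 0) ≤ d) →
      ∃ (l : ↥X₀ →ₗ[ℝ] ℝ) (c : ℝ), (∀ h ∈ H, ∀ x' : ↥X₀, h ≤ (x' : ↥(ProjLim p)) →
        q1 ((h : ∀ m, X m) 0) ≤ l x' + c) ∧ l x + c ≤ d := by
    intro n x d hd
    let A : ↥X₀ → Set ℝ := fun y =>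
      {r | ∃ h ∈ H, (h : ∀ m, X m) n ≤ (y : ↥(ProjLim p)).1 n ∧ r = q1 ((h : ∀ m, X m) 0)}
    have hne : ∀ y, (A y).Nonempty := by
      intro y
      obtain ⟨_, ⟨h, hh, rfl⟩, hle⟩ := hmin n _ ⟨y, y.2, rfl⟩
      exact ⟨_, h, hh, hle, rfl⟩
    have hbdd : ∀ y, BddAbove (A y) := by
      intro y
      refine ⟨q1 ((y : ↥(ProjLim p)).1 0), ?_⟩
      rintro _ ⟨h, -, hle, rfl⟩
      exact hq1mono (ProjLim.apply_le_of_le hp n.zero_le hle)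
    obtain ⟨l, hl⟩ := exists_linear_support_of_concave (fun y => sSup (A y)) (by
      intro t h0 h1 a b
      refine combination_csSup_le_csSup (hne a) (hne b) (hbdd _) h0 h1 ?_
      rintro _ ⟨h, hh, hle, rfl⟩ _ ⟨h', hh', hle', rfl⟩
      exact ⟨_, ⟨_, hHconv t h0 h1 h hh h' hh',
        add_le_add (smul_le_smul_of_nonneg_left hle h0.le)
          (smul_le_smul_of_nonneg_left hle' (by linarith)), rfl⟩, hq1conc t h0 h1 _ _⟩) x
    refine ⟨l, sSup (A x) - l x, fun h hh x' hle => ?_, ?_⟩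
    · have h1 := le_csSup (hbdd x') ⟨h, hh, hle n, rfl⟩
      have h2 := hl x'
      rw [map_sub] at h2
      linarith
    · have : sSup (A x) ≤ d := csSup_le (hne x) <| by
        rintro _ ⟨h, hh, hle, rfl⟩
        exact hd h hh hle
      linarith
  have happrox : ∀ (x : ↥X₀) (d : ℝ),
      spf H (fun x' : ↥(ProjLim p) => q1 ((x' : ∀ m, X m) 0)) x < d →
      ∃ (l : ↥X₀ →ₗ[ℝ] ℝ) (c : ℝ), (∀ h ∈ H, ∀ x' : ↥X₀, h ≤ (x' : ↥(ProjLim p)) →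
        q1 ((h : ∀ m, X m) 0) ≤ l x' + c) ∧ l x + c ≤ d := by
    intro x d hd
    by_contra hcon
    have hc : ∀ n, ∃ h ∈ H, (h : ∀ m, X m) n ≤ (x : ↥(ProjLim p)).1 n ∧
        d ≤ q1 ((h : ∀ m, X m) 0) := by
      intro n
      by_contra hn
      push Not at hn
      exact hcon (hsupport n x d fun h hh hle => (hn h hh hle).le)
    obtain ⟨g, hg, hgx, hdg⟩ :=
      ProjLim.exists_le_of_forall_apply_le hp hreg hq1mono hlimsup hqv hc
    exact absurd hd (not_lt.2 ((EReal.coe_le_coe_iff.2 hdg).trans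
      (le_spf (q := fun x' : ↥(ProjLim p) => q1 ((x' : ∀ m, X m) 0)) hg hgx)))
  have hqm : Monotone fun x' : ↥(ProjLim p) => q1 ((x' : ∀ m, X m) 0) :=
    fun _ _ hab => hq1mono (hab 0)
  refine ⟨fun t h0 h1 x y => spf_concave hqm h0 h1
    (fun a b => hq1conc t h0 h1 _ _) (hHconv t h0 h1) x y, fun x hx => le_antisymm ?_ ?_, ?_⟩
  · refine le_sInf ?_
    rintro _ ⟨a, -, ha, rfl⟩
    exact spf_le fun h hh hle => EReal.coe_le_coe_iff.2 (ha h hh ⟨x, hx⟩ hle)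
  · refine EReal.le_of_forall_lt_iff_le.1 fun d hd => ?_
    obtain ⟨l, c, hlc, hle⟩ := happrox ⟨x, hx⟩ d hd
    refine le_trans (sInf_le ⟨fun y => l y + c, fun t _ _ u v => ?_, hlc, rfl⟩)
      (EReal.coe_le_coe_iff.2 hle)
    dsimp only
    rw [map_add, map_smul, map_smul, smul_eq_mul, smul_eq_mul]
    ring
  · intro h0H hq0
    refine ⟨fun x hx => le_trans (EReal.coe_le_coe_iff.2 hq0)
      (le_spf (q := fun x' : ↥(ProjLim p) => q1 ((x' : ∀ m, X m) 0)) h0H hx),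
      fun x hx => le_antisymm ?_ ?_⟩
    · refine le_sInf ?_
      rintro _ ⟨l, c, -, -, ha, rfl⟩
      exact spf_le fun h hh hle => EReal.coe_le_coe_iff.2 (ha h hh ⟨x, hx⟩ hle)
    · refine EReal.le_of_forall_lt_iff_le.1 fun d hd => ?_
      obtain ⟨l, c, hlc, hle⟩ := happrox ⟨x, hx⟩ d hd
      have hnonneg : ∀ x' : ↥X₀, 0 ≤ (x' : ↥(ProjLim p)) → 0 ≤ l x' + c :=
        fun x' hx' => hq0.trans (hlc 0 h0H x' hx')
      refine le_trans
        (sInf_le ⟨l, c, by simpa using hnonneg 0 le_rfl, fun x' hx' => ?_, hlc, rfl⟩)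
        (EReal.coe_le_coe_iff.2 hle)
      by_contra! hneg
      have ht : 0 ≤ (|c| + 1) / -l x' := div_nonneg (by positivity) (by linarith)
      have h1 := hnonneg (((|c| + 1) / -l x') • x') (smul_nonneg ht hx')
      have h2 : (|c| + 1) / -l x' * l x' = -(|c| + 1) := by
        have := hneg.ne
        field_simp
      rw [map_smul, smul_eq_mul, h2] at h1
      linarith [le_abs_self c]
end
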